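/- Let A be a C*-algebra and let φ, ψ : A → M_n(ℂ) be two *-homomorphisms into the n×n complex matrices such that rank(φ(a)) = rank(ψ(a)) for every a ∈ A. Then there exists a unitary matrix u ∈ M_n(ℂ) such that ψ(a) = u φ(a) u* for all a ∈ A. -/

import Mathlib

section Aux

open scoped ComplexOrder

open Matrix in
theorem aux_cont {n : ℕ} (M : Matrix (Fin n) (Fin n) ℂ) (f : ℝ → ℝ) :
    ContinuousOn f (spectrum ℝ M) :=
  Set.Finite.continuousOn (Matrix.finite_real_spectrum) f

open Matrix in
theorem aux_polar {n : ℕ} (S : Matrix (Fin n) (Fin n) ℂ) (hS : S ≠ 0) :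
    ∃ G : Matrix (Fin n) (Fin n) ℂ, Gᴴ = G ∧ (∀ B, Commute (Sᴴ * S) B → Commute G B) ∧
      S * G * (S * G)ᴴ * (S * G) = S * G ∧ S * G ≠ 0 := by
  have hpos : (Sᴴ * S).PosSemidef := posSemidef_conjTranspose_mul_self S
  have hsa : IsSelfAdjoint (Sᴴ * S) := hpos.isHermitian
  have hspec : ∀ x ∈ spectrum ℝ (Sᴴ * S), 0 ≤ x := by
    intro x hx
    rw [hpos.isHermitian.spectrum_real_eq_range_eigenvalues] at hx
    obtain ⟨i, rfl⟩ := hx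
    exact hpos.eigenvalues_nonneg i
  set H := Sᴴ * S with hH
  let g : ℝ → ℝ := fun x => (Real.sqrt x)⁻¹
  have hid : cfc (fun x : ℝ => x) H = H := cfc_id' ℝ H
  have hGs : (cfc g H)ᴴ = cfc g H := (cfc_predicate g H : IsSelfAdjoint _)
  have h1 : cfc g H * cfc g H * H * cfc g H = cfc g H := by
    nth_rewrite 3 [← hid]
    rw [← cfc_mul g g H (aux_cont _ _) (aux_cont _ _), ← cfc_mul _ _ H (aux_cont _ _) (aux_cont _ _),
      ← cfc_mul _ _ H (aux_cont _ _) (aux_cont _ _)]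
    apply cfc_congr
    intro x hx
    have hx0 := hspec x hx
    simp only [g]
    rcases hx0.eq_or_lt with h0 | h0
    · simp [← h0]
    · have := Real.sqrt_pos.2 h0
      have h2 := Real.mul_self_sqrt hx0
      field_simp
      nlinarith
  have h2 : H * cfc g H * cfc g H * H = H := by
    nth_rewrite 1 [← hid]
    nth_rewrite 4 [← hid]
    rw [← cfc_mul _ _ H (aux_cont _ _) (aux_cont _ _), ← cfc_mul _ _ H (aux_cont _ _) (aux_cont _ _),
      ← cfc_mul _ _ H (aux_cont _ _) (aux_cont _ _)]
    conv_rhs => rw [← hid]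
    apply cfc_congr
    intro x hx
    have hx0 := hspec x hx
    simp only [g]
    rcases hx0.eq_or_lt with h0 | h0
    · simp [← h0]
    · have := Real.sqrt_pos.2 h0
      have h2 := Real.mul_self_sqrt hx0
      field_simp
      nlinarith
  refine ⟨cfc g H, hGs, fun B hB => hB.cfc_real g, ?_, ?_⟩
  · rw [conjTranspose_mul, hGs]
    calc S * cfc g H * (cfc g H * Sᴴ) * (S * cfc g H)
        = S * (cfc g H * cfc g H * (Sᴴ * S) * cfc g H) := by simp only [mul_assoc]
      _ = _ := by rw [← hH, h1]
  · intro h0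
    apply hS
    have : H = 0 := by
      rw [← h2]
      have : H * cfc g H = 0 := by rw [hH, mul_assoc, ← hH, h0, mul_zero]
      rw [this]; simp
    exact (conjTranspose_mul_self_eq_zero).1 this

open Matrix in
theorem aux_trace_idem {n : ℕ} (P : Matrix (Fin n) (Fin n) ℂ) (hP : P * P = P) :
    P.trace = (P.rank : ℂ) := by
  have h : IsIdempotentElem (Matrix.toLin' P) := by
    unfold IsIdempotentElem
    rw [Module.End.mul_eq_comp, ← Matrix.toLin'_mul, hP]
  have := (LinearMap.IsIdempotentElem.isProj_range _ h).trace
  rw [Matrix.trace_toLin'_eq] at this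
  rw [this]
  rfl

open Matrix Polynomial in
theorem aux_rank_aeval {n : ℕ} (M : Matrix (Fin n) (Fin n) ℂ) (hM : M.IsHermitian) (p : ℂ[X]) :
    (aeval M p).rank = Fintype.card {i // p.eval (hM.eigenvalues i : ℂ) ≠ 0} := by
  have h1 : aeval M p = (Unitary.conjStarAlgAut ℂ (Matrix (Fin n) (Fin n) ℂ)) hM.eigenvectorUnitary
      (diagonal fun i => p.eval (hM.eigenvalues i : ℂ)) := by
    conv_lhs => rw [hM.spectral_theorem]
    rw [show ∀ x, (Unitary.conjStarAlgAut ℂ (Matrix (Fin n) (Fin n) ℂ)) hM.eigenvectorUnitary x =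
      ((Unitary.conjStarAlgAut ℂ (Matrix (Fin n) (Fin n) ℂ)) hM.eigenvectorUnitary :
        _ →⋆ₐ[ℂ] _).toAlgHom x from fun _ => rfl, Polynomial.aeval_algHom_apply]
    refine congrArg (fun x => (Unitary.conjStarAlgAut ℂ (Matrix (Fin n) (Fin n) ℂ))
      hM.eigenvectorUnitary x) ?_
    rw [show (diagonal (RCLike.ofReal ∘ hM.eigenvalues) : Matrix (Fin n) (Fin n) ℂ) =
      diagonalAlgHom ℂ (RCLike.ofReal ∘ hM.eigenvalues) from rfl, Polynomial.aeval_algHom_apply]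
    simp only [diagonalAlgHom_apply]
    congr 1
    ext i
    rw [Polynomial.aeval_pi_apply]
    simp [Polynomial.aeval_def, Polynomial.eval₂_eq_eval_map]
  rw [h1, ← Matrix.rank_diagonal]
  rw [Unitary.conjStarAlgAut_apply, ← Unitary.coe_star]
  simp [-isUnit_iff_ne_zero, -Unitary.coe_star]

open Matrix Polynomial in
theorem aux_hom {A : Type*} [CStarAlgebra A] (n : ℕ)
    (φ : A →⋆ₙₐ[ℂ] Matrix (Fin n) (Fin n) ℂ) (a : A) (p : ℂ[X]) :
    φ (a * aeval a p) = aeval (φ a) (X * p) := by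
  induction p using Polynomial.induction_on' with
  | add p q hp hq => simp only [map_add, mul_add, hp, hq]
  | monomial k c =>
    induction k generalizing c with
    | zero => simp [Algebra.algebraMap_eq_smul_one]
    | succ k ih =>
      have : (monomial (k+1) c : ℂ[X]) = monomial k c * X := by simp
      rw [this, map_mul (aeval a), aeval_X, ← mul_assoc, map_mul φ, ih, ← mul_assoc,
        map_mul (aeval (φ a)) (X * _), aeval_X]

open Matrix Polynomial in
theorem aux_trace {A : Type*} [CStarAlgebra A] (n : ℕ)
    (φ ψ : A →⋆ₙₐ[ℂ] Matrix (Fin n) (Fin n) ℂ)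
    (h : ∀ a : A, (φ a).rank = (ψ a).rank) (a : A) : (φ a).trace = (ψ a).trace := by
  have key : ∀ a : A, IsSelfAdjoint a → (φ a).trace = (ψ a).trace := by
    intro a ha
    have hM : (φ a).IsHermitian := ha.map φ
    have hN : (ψ a).IsHermitian := ha.map ψ
    have hc : ∀ p : ℂ[X], Fintype.card {i // (X * p).eval (hM.eigenvalues i : ℂ) ≠ 0} =
        Fintype.card {i // (X * p).eval (hN.eigenvalues i : ℂ) ≠ 0} := by
      intro p
      rw [← aux_rank_aeval, ← aux_rank_aeval, ← aux_hom, ← aux_hom, h]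
    rw [hM.trace_eq_sum_eigenvalues, hN.trace_eq_sum_eigenvalues]
    classical
    let S : Finset ℝ := Finset.univ.image hM.eigenvalues ∪ Finset.univ.image hN.eigenvalues
    have e : ∀ f : Fin n → ℝ, (∀ i, f i ∈ S) →
        ∑ i, ((f i : ℝ) : ℂ) = ∑ l ∈ S, (l : ℂ) * (Fintype.card {i // f i = l} : ℂ) := by
      intro f hf
      rw [← Finset.sum_fiberwise_of_maps_to (s := Finset.univ) (t := S) (g := f) (fun i _ => hf i)]
      refine Finset.sum_congr rfl fun l _ => ?_
      rw [Finset.sum_congr rfl (g := fun _ => (l : ℂ))]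
      · simp [Fintype.card_subtype, mul_comm]
      · intro i hi
        rw [(Finset.mem_filter.1 hi).2]
    have hMS : ∀ i, hM.eigenvalues i ∈ S := fun i => by simp [S]
    have hNS : ∀ i, hN.eigenvalues i ∈ S := fun i => by simp [S]
    change ∑ i, ((hM.eigenvalues i : ℝ) : ℂ) = ∑ i, ((hN.eigenvalues i : ℝ) : ℂ)
    rw [e _ hMS, e _ hNS]
    refine Finset.sum_congr rfl fun l hl => ?_
    by_cases hl0 : l = 0
    · simp [hl0]
    congr 2
    let p : ℂ[X] := ∏ m ∈ S.erase l, (X - C (m : ℂ))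
    have hp : ∀ x ∈ S, (X * p).eval (x : ℂ) ≠ 0 ↔ x = l := by
      intro x hx
      simp only [p, eval_mul, eval_X, eval_prod, eval_sub, eval_C, ne_eq, mul_eq_zero,
        Finset.prod_eq_zero_iff, not_or]
      constructor
      · rintro ⟨_, h2⟩
        by_contra hne
        exact h2 ⟨x, Finset.mem_erase.2 ⟨hne, hx⟩, by simp⟩
      · rintro rfl
        refine ⟨by exact_mod_cast hl0, ?_⟩
        rintro ⟨m, hm, hm2⟩
        rw [sub_eq_zero] at hm2
        exact (Finset.mem_erase.1 hm).1 (by exact_mod_cast hm2.symm)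
    have := hc p
    rw [Fintype.card_congr (Equiv.subtypeEquivRight fun i => hp _ (hMS i)),
      Fintype.card_congr (Equiv.subtypeEquivRight fun i => hp _ (hNS i))] at this
    exact this
  rw [← realPart_add_I_smul_imaginaryPart a]
  simp only [map_add, map_smul, trace_add, trace_smul]
  rw [key _ (realPart a).2, key _ (imaginaryPart a).2]

/-- Lift of an orthonormal basis of the range. -/
theorem aux_basis {A : Type*} [CStarAlgebra A] (n : ℕ)
    (φ : A →⋆ₙₐ[ℂ] Matrix (Fin n) (Fin n) ℂ) :
    ∃ (m : ℕ) (e : Fin m → A), ∀ a, φ a = ∑ i, (φ (star (e i) * a)).trace • φ (e i) := by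
  let R : Submodule ℂ (Matrix (Fin n) (Fin n) ℂ) := LinearMap.range (φ : A →ₗ[ℂ] _)
  let _ : NormedAddCommGroup (Matrix (Fin n) (Fin n) ℂ) :=
    Matrix.toMatrixNormedAddCommGroup 1 Matrix.PosDef.one
  let _ : InnerProductSpace ℂ (Matrix (Fin n) (Fin n) ℂ) :=
    Matrix.toMatrixInnerProductSpace 1 Matrix.PosDef.one.posSemidef
  let b := stdOrthonormalBasis ℂ R
  have hb : ∀ i, ∃ a, φ a = (b i : Matrix (Fin n) (Fin n) ℂ) := fun i => (b i).2
  choose e he using hb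
  refine ⟨_, e, fun a => ?_⟩
  have := b.sum_repr' ⟨φ a, a, rfl⟩
  have := congrArg Subtype.val this
  refine this.symm.trans ?_
  simp only [Submodule.coe_sum, Submodule.coe_smul, ← he]
  refine Finset.sum_congr rfl fun i _ => ?_
  congr 1
  rw [Submodule.coe_inner]
  change (φ a * 1 * (b i : Matrix (Fin n) (Fin n) ℂ).conjTranspose).trace = _
  rw [← he, mul_one, Matrix.trace_mul_comm, map_mul, map_star]
  rfl

open Matrix in
theorem aux_entry {n : ℕ} (B D : Matrix (Fin n) (Fin n) ℂ) (p j k q : Fin n) :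
    (B * (single j k 1 : Matrix (Fin n) (Fin n) ℂ) * D : Matrix (Fin n) (Fin n) ℂ) p q = B p j * D k q := by
  rw [Matrix.mul_apply, Finset.sum_eq_single k]
  · rw [Matrix.mul_single_apply_same, mul_one]
  · intro b _ hb
    rw [Matrix.mul_single_apply_of_ne (hbj := hb), zero_mul]
  · simp

open Matrix in
theorem aux_rank_zero {n : ℕ} (B : Matrix (Fin n) (Fin n) ℂ) (h : B.rank = 0) : B = 0 := by
  have h1 : LinearMap.range B.mulVecLin = ⊥ := Submodule.finrank_eq_zero.1 h
  rw [LinearMap.range_eq_bot] at h1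
  ext i j
  have := congrFun (LinearMap.congr_fun h1 (Pi.single j 1)) i
  simpa using this

open Matrix in
/-- A non-zero intertwiner between the remaining corners. -/
theorem aux_inter {A : Type*} [CStarAlgebra A] (n : ℕ)
    (φ ψ : A →⋆ₙₐ[ℂ] Matrix (Fin n) (Fin n) ℂ)
    (h : ∀ a : A, (φ a).rank = (ψ a).rank)
    (P Q : Matrix (Fin n) (Fin n) ℂ) (hPs : Pᴴ = P) (hQs : Qᴴ = Q)
    (hP : P * P = P) (hQ : Q * Q = Q) (hP0 : P ≠ 0) (hQ0 : Q ≠ 0)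
    (hPc : ∀ a, Commute P (φ a)) (hQc : ∀ a, Commute Q (ψ a))
    (ht : ∀ a, (φ a * P).trace = (ψ a * Q).trace) :
    ∃ S : Matrix (Fin n) (Fin n) ℂ, S ≠ 0 ∧ Q * S = S ∧ S * P = S ∧
      ∀ a, S * φ a = ψ a * S := by
  obtain ⟨m, e, he⟩ := aux_basis n φ
  have hker : ∀ c, φ c = 0 → ψ c = 0 := by
    intro c hc
    have := h c
    rw [hc, rank_zero] at this
    exact aux_rank_zero _ this.symm
  have heψ : ∀ a, ψ a = ∑ i, (φ (star (e i) * a)).trace • ψ (e i) := by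
    intro a
    have h1 : φ (a - ∑ i, (φ (star (e i) * a)).trace • e i) = 0 := by
      rw [map_sub, map_sum]
      simp only [map_smul]
      rw [← he, sub_self]
    have := hker _ h1
    rw [map_sub, map_sum, sub_eq_zero] at this
    simpa only [map_smul] using this
  have heψ' : ∀ a, ψ a = ∑ i, (φ (a * e i)).trace • ψ (star (e i)) := by
    intro a
    have := congrArg star (heψ (star a))
    rw [map_star, star_star] at this
    rw [this, star_sum]
    refine Finset.sum_congr rfl fun i _ => ?_
    rw [star_smul, ← map_star ψ, ← star_mul, map_star φ, star_eq_conjTranspose (φ _),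
      trace_conjTranspose, star_star]
  -- the averaged maps intertwine
  have hcas : ∀ (X : Matrix (Fin n) (Fin n) ℂ) (a : A),
      (∑ i, ψ (star (e i)) * X * φ (e i)) * φ a = ψ a * ∑ i, ψ (star (e i)) * X * φ (e i) := by
    intro X a
    have l : ∀ i, ψ (star (e i)) * X * φ (e i) * φ a =
        ∑ j, (φ (star (e j) * (e i * a))).trace • (ψ (star (e i)) * X * φ (e j)) := by
      intro i
      rw [mul_assoc _ (φ (e i)), ← map_mul, he (e i * a), Finset.mul_sum]
      simp only [mul_smul_comm]
    have r : ∀ j, ψ a * (ψ (star (e j)) * X * φ (e j)) =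
        ∑ i, (φ (a * star (e j) * e i)).trace • (ψ (star (e i)) * X * φ (e j)) := by
      intro j
      rw [← mul_assoc, ← mul_assoc, ← map_mul, heψ' (a * star (e j)), Finset.sum_mul,
        Finset.sum_mul]
      simp only [smul_mul_assoc]
    rw [Finset.sum_mul, Finset.mul_sum, Finset.sum_congr rfl fun i _ => l i,
      Finset.sum_congr rfl fun i _ => r i, Finset.sum_comm]
    refine Finset.sum_congr rfl fun j _ => Finset.sum_congr rfl fun i _ => ?_
    congr 1
    rw [mul_assoc a, map_mul φ a, trace_mul_comm, ← map_mul, mul_assoc]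
  by_cases hX : ∃ X, Q * (∑ i, ψ (star (e i)) * X * φ (e i)) * P ≠ 0
  · obtain ⟨X, hX⟩ := hX
    refine ⟨_, hX, ?_, ?_, ?_⟩
    · simp only [← mul_assoc, hQ]
    · simp only [mul_assoc, hP]
    · intro a
      rw [mul_assoc, (hPc a).eq, ← mul_assoc, mul_assoc Q, hcas, ← mul_assoc, (hQc a).eq]
      simp only [mul_assoc]
  · push Not at hX
    have h0 : ∀ j k, ∑ i, (Q * ψ (star (e i))) j j * (φ (e i) * P) k k = 0 := by
      intro j k
      have := congrFun (congrFun (hX (single j k 1)) j) k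
      rw [Finset.mul_sum, Finset.sum_mul, Matrix.sum_apply] at this
      rw [Matrix.zero_apply] at this
      rw [← this]
      refine Finset.sum_congr rfl fun i _ => ?_
      rw [show Q * (ψ (star (e i)) * single j k 1 * φ (e i)) * P =
        (Q * ψ (star (e i))) * single j k 1 * (φ (e i) * P) by simp only [mul_assoc]]
      rw [aux_entry]
    have h1 : ∑ i, (Q * ψ (star (e i))).trace * (φ (e i) * P).trace = 0 := by
      simp only [Matrix.trace, Matrix.diag, Finset.sum_mul_sum]
      rw [Finset.sum_comm]
      refine Finset.sum_eq_zero fun j _ => ?_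
      rw [Finset.sum_comm]
      exact Finset.sum_eq_zero fun k _ => h0 j k
    have h2 : ∀ i, (Q * ψ (star (e i))).trace = star (φ (e i) * P).trace := by
      intro i
      rw [trace_mul_comm, ← ht, map_star, ← trace_conjTranspose, conjTranspose_mul, hPs,
        trace_mul_comm]
      rfl
    have h3 : ∀ i, (φ (e i) * P).trace = 0 := by
      simp only [h2] at h1
      rw [Finset.sum_eq_zero_iff_of_nonneg (fun i _ => star_mul_self_nonneg _)] at h1
      intro i
      simpa using h1 i (Finset.mem_univ i)
    have h4 : ∀ a, (φ a * P).trace = 0 := by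
      intro a
      rw [he a, Finset.sum_mul, trace_sum]
      refine Finset.sum_eq_zero fun i _ => ?_
      rw [smul_mul_assoc, trace_smul, h3, smul_zero]
    have hz : ∀ (χ : A →⋆ₙₐ[ℂ] Matrix (Fin n) (Fin n) ℂ) (P : Matrix (Fin n) (Fin n) ℂ),
        Pᴴ = P → P * P = P → (∀ a, (χ a * P).trace = 0) → ∀ a, χ a * P = 0 := by
      intro χ P hPs hP h4 a
      rw [← trace_conjTranspose_mul_self_eq_zero_iff, ← h4 (star a * a), conjTranspose_mul, hPs,
        mul_assoc, trace_mul_comm, mul_assoc, mul_assoc, hP, map_mul, map_star, mul_assoc]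
      rfl
    have h5 := hz φ P hPs hP h4
    have h6 := hz ψ Q hQs hQ (fun a => by rw [← ht, h4])
    obtain ⟨j, k, hjk⟩ : ∃ j k, Q j k ≠ 0 := by
      by_contra hc
      push Not at hc
      exact hQ0 (by ext j k; exact hc j k)
    obtain ⟨l, r, hlr⟩ : ∃ j k, P j k ≠ 0 := by
      by_contra hc
      push Not at hc
      exact hP0 (by ext j k; exact hc j k)
    refine ⟨Q * single k l 1 * P, ?_, ?_, ?_, ?_⟩
    · intro h0
      have := congrFun (congrFun h0 j) r
      rw [aux_entry, Matrix.zero_apply] at this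
      exact mul_ne_zero hjk hlr this
    · simp only [← mul_assoc, hQ]
    · simp only [mul_assoc, hP]
    · intro a
      rw [mul_assoc, (hPc a).eq, h5, mul_zero, ← mul_assoc, ← mul_assoc, h6]
      simp

open Matrix in
theorem aux_main {A : Type*} [CStarAlgebra A] (n : ℕ)
    (φ ψ : A →⋆ₙₐ[ℂ] Matrix (Fin n) (Fin n) ℂ)
    (h : ∀ a : A, (φ a).rank = (ψ a).rank) :
    ∃ T : Matrix (Fin n) (Fin n) ℂ, Tᴴ * T = 1 ∧ ∀ a, T * φ a = ψ a * T := by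
  let C : Matrix (Fin n) (Fin n) ℂ → Prop := fun T =>
    T * Tᴴ * T = T ∧ ∀ a, T * φ a = ψ a * T
  have hrank : ∀ T, C T → (Tᴴ * T).trace = (T.rank : ℂ) := by
    intro T hT
    rw [aux_trace_idem, rank_conjTranspose_mul_self]
    rw [mul_assoc, ← mul_assoc T, hT.1]
  obtain ⟨T, hT, hmax⟩ : ∃ T, C T ∧ ∀ T', C T' → T'.rank ≤ T.rank := by
    have hne : ∃ k, ∃ T, C T ∧ n - T.rank = k := ⟨_, 0, ⟨by simp, by simp⟩, rfl⟩
    classical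
    obtain ⟨T, hT, hk⟩ := Nat.find_spec hne
    refine ⟨T, hT, fun T' hT' => ?_⟩
    have := Nat.find_min' hne ⟨T', hT', rfl⟩
    have h1 := T.rank_le_height
    have h2 := T'.rank_le_height
    omega
  refine ⟨T, ?_, hT.2⟩
  by_contra hne
  obtain ⟨hT1, hT2⟩ := hT
  have hT1' : Tᴴ * T * Tᴴ = Tᴴ := by
    have := congrArg conjTranspose hT1
    simpa [conjTranspose_mul, mul_assoc] using this
  have hT2' : ∀ a, φ a * Tᴴ = Tᴴ * ψ a := by
    intro a
    have := congrArg conjTranspose (hT2 (star a))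
    rw [conjTranspose_mul, conjTranspose_mul, map_star, map_star, star_eq_conjTranspose,
      star_eq_conjTranspose, conjTranspose_conjTranspose, conjTranspose_conjTranspose] at this
    exact this
  obtain ⟨S, hS0, hQS, hSP, hSc⟩ := aux_inter n φ ψ h (1 - Tᴴ * T) (1 - T * Tᴴ)
    (by simp [conjTranspose_mul]) (by simp [conjTranspose_mul])
    (by rw [mul_sub, sub_mul, sub_mul, ← mul_assoc (Tᴴ * T), hT1']; simp)
    (by rw [mul_sub, sub_mul, sub_mul, ← mul_assoc (T * Tᴴ), hT1]; simp)
    (fun h0 => hne (sub_eq_zero.1 h0).symm)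
    (fun h0 => hne (mul_eq_one_comm.1 (sub_eq_zero.1 h0).symm))
    (fun a => by
      refine (Commute.one_left _).sub_left ?_
      change Tᴴ * T * φ a = φ a * (Tᴴ * T)
      rw [mul_assoc, hT2, ← mul_assoc, ← mul_assoc, hT2'])
    (fun a => by
      refine (Commute.one_left _).sub_left ?_
      change T * Tᴴ * ψ a = ψ a * (T * Tᴴ)
      rw [mul_assoc, ← hT2', ← mul_assoc, ← mul_assoc, hT2])
    (fun a => by
      rw [mul_sub, mul_sub, trace_sub, trace_sub, mul_one, mul_one, aux_trace n φ ψ h]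
      congr 1
      rw [← mul_assoc, ← mul_assoc, ← hT2, trace_mul_comm, ← mul_assoc, trace_mul_comm (T * φ a),
        ← mul_assoc])
  obtain ⟨G, hGs, hGc, hW, hW0⟩ := aux_polar S hS0
  have hSc' : ∀ a, φ a * Sᴴ = Sᴴ * ψ a := by
    intro a
    have := congrArg conjTranspose (hSc (star a))
    rw [conjTranspose_mul, conjTranspose_mul, map_star, map_star, star_eq_conjTranspose,
      star_eq_conjTranspose, conjTranspose_conjTranspose, conjTranspose_conjTranspose] at this
    exact this
  have hTS : Tᴴ * S = 0 := by
    rw [← hQS, ← mul_assoc, mul_sub, ← mul_assoc, hT1']; simp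
  have hST : S * Tᴴ = 0 := by
    rw [← hSP, mul_assoc, sub_mul, hT1']; simp
  have hGT : G * (Tᴴ * T) = Tᴴ * T * G := by
    refine (hGc _ ?_).eq
    change Sᴴ * S * (Tᴴ * T) = Tᴴ * T * (Sᴴ * S)
    rw [mul_assoc Sᴴ, ← mul_assoc S, hST, ← mul_assoc (Tᴴ * T), mul_assoc Tᴴ T]
    have : T * Sᴴ = 0 := by
      have := congrArg conjTranspose hST
      simpa [conjTranspose_mul] using this
    rw [this]; simp
  set W := S * G with hWdef
  have hWT : W * Tᴴ = 0 := by
    rw [← hT1', hWdef, mul_assoc, ← mul_assoc G, hGT, ← mul_assoc, ← mul_assoc, ← mul_assoc, hST]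
    simp
  have hTW : Tᴴ * W = 0 := by rw [hWdef, ← mul_assoc, hTS, zero_mul]
  have hTW' : T * Wᴴ = 0 := by
    have := congrArg conjTranspose hWT
    simpa [conjTranspose_mul] using this
  have hWT' : Wᴴ * T = 0 := by
    have := congrArg conjTranspose hTW
    simpa [conjTranspose_mul] using this
  have hWc : ∀ a, W * φ a = ψ a * W := by
    intro a
    have : Commute G (φ a) := by
      refine hGc _ ?_
      change Sᴴ * S * φ a = φ a * (Sᴴ * S)
      rw [mul_assoc, hSc, ← mul_assoc, ← mul_assoc, hSc']
    rw [hWdef, mul_assoc, this.eq, ← mul_assoc, hSc, mul_assoc]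
  have hCW : C W := ⟨hW, hWc⟩
  have hCTW : C (T + W) := by
    refine ⟨?_, fun a => by rw [add_mul, mul_add, hT2, hWc]⟩
    rw [conjTranspose_add, add_mul T W, mul_add T, mul_add W, hTW', hWT]
    simp only [add_zero, zero_add, add_mul, mul_add]
    rw [hT1, hW, mul_assoc T, hTW, mul_assoc W, hWT']
    simp
  have h1 := hrank _ hCTW
  rw [conjTranspose_add, add_mul, mul_add, mul_add, hTW, hWT', add_zero, zero_add, trace_add,
    hrank _ ⟨hT1, hT2⟩, hrank _ hCW] at h1
  have h2 : T.rank + W.rank = (T + W).rank := by exact_mod_cast h1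
  have h3 := hmax _ hCTW
  have h4 : W.rank = 0 := by omega
  exact hW0 (aux_rank_zero _ h4)

end Aux

theorem stmt15 {A : Type*} [CStarAlgebra A] (n : ℕ)
    (φ ψ : A →⋆ₙₐ[ℂ] Matrix (Fin n) (Fin n) ℂ)
    (h : ∀ a : A, (φ a).rank = (ψ a).rank) :
    ∃ u ∈ Matrix.unitaryGroup (Fin n) ℂ,
      ∀ a : A, ψ a = u * φ a * star u := by
  obtain ⟨T, hT, hc⟩ := aux_main n φ ψ h
  refine ⟨T, Matrix.mem_unitaryGroup_iff'.2 hT, fun a => ?_⟩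
  rw [hc, mul_assoc, Matrix.star_eq_conjTranspose, mul_eq_one_comm.1 hT, mul_one]
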